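/- arXiv:2307.04212 — 2 statements merged into one kernel-verified Lean document; each statement's English description precedes it below -/
import Mathlib

section
/- Let w, z : [0,1] → ℝ be continuous. Let l̄, η̄, p̄ ≥ 0 and D̄ ≥ 0, and suppose l : [0,1]² → ℝ satisfies |l(x,y)| ≤ l̄ for 0 ≤ y ≤ x ≤ 1, η : [0,1]² → ℝ satisfies |η(x,y)| ≤ η̄, p : [0,1] → ℝ satisfies |p(s)| ≤ p̄, and 0 ≤ D̂ ≤ D̄. Define u(x) = w(x) + ∫₀ˣ l(x,y)·w(y) dy and v(x) = z(x) + ∫₀¹ η(x,y)·w(y) dy + D̂·∫₀ˣ p(x−y)·z(y) dy. Then ‖u‖² + ‖v‖² ≤ (2 + 2l̄² + 3η̄²)·‖w‖² + (3 + 3D̄²p̄²)·‖z‖². -/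
theorem sq_integral_abs_le_integral_sq {f : ℝ → ℝ} (hf : ContinuousOn f (Set.Icc (0 : ℝ) 1)) :
    (∫ y in (0 : ℝ)..1, |f y|) ^ 2 ≤ ∫ y in (0 : ℝ)..1, (f y) ^ 2 := by
  have hf' : ContinuousOn f (Set.uIcc (0 : ℝ) 1) := by rwa [Set.uIcc_of_le zero_le_one]
  have h_abs : IntervalIntegrable (fun y => |f y|) MeasureTheory.volume 0 1 :=
    hf'.abs.intervalIntegrable
  have h_sq : IntervalIntegrable (fun y => (f y) ^ 2) MeasureTheory.volume 0 1 :=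
    (hf'.pow 2).intervalIntegrable
  set c := ∫ y in (0 : ℝ)..1, |f y| with hc
  have h_nonneg : 0 ≤ ∫ y in (0 : ℝ)..1, ((f y) ^ 2 - 2 * c * |f y| + c ^ 2) := by
    refine intervalIntegral.integral_nonneg zero_le_one fun y _ => ?_
    nlinarith [sq_nonneg (|f y| - c), sq_abs (f y)]
  rw [intervalIntegral.integral_add (h_sq.sub (h_abs.const_mul _)) intervalIntegrable_const,
    intervalIntegral.integral_sub h_sq (h_abs.const_mul _),
    intervalIntegral.integral_const_mul, ← hc, intervalIntegral.integral_const] at h_nonneg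
  simp only [sub_zero, one_smul] at h_nonneg
  nlinarith

/-- No measurability of the kernel `k` is needed: the integral of a non-integrable function
is zero. -/
theorem sq_integral_kernel_mul_le {f k : ℝ → ℝ} {C x : ℝ}
    (hf : ContinuousOn f (Set.Icc (0 : ℝ) 1)) (hx : x ∈ Set.Icc (0 : ℝ) 1) (hC : 0 ≤ C)
    (hk : ∀ y, 0 ≤ y → y ≤ x → |k y| ≤ C) :
    (∫ y in (0 : ℝ)..x, k y * f y) ^ 2 ≤ C ^ 2 * ∫ y in (0 : ℝ)..1, (f y) ^ 2 := by
  have hf' : ContinuousOn f (Set.uIcc (0 : ℝ) 1) := by rwa [Set.uIcc_of_le zero_le_one]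
  have h_int : IntervalIntegrable (fun y => C * |f y|) MeasureTheory.volume 0 1 :=
    hf'.abs.intervalIntegrable.const_mul C
  have h_int_x : IntervalIntegrable (fun y => C * |f y|) MeasureTheory.volume 0 x :=
    h_int.mono_set (by
      rw [Set.uIcc_of_le hx.1, Set.uIcc_of_le zero_le_one]
      exact Set.Icc_subset_Icc_right hx.2)
  have h_le : |∫ y in (0 : ℝ)..x, k y * f y| ≤ C * ∫ y in (0 : ℝ)..1, |f y| := by
    calc |∫ y in (0 : ℝ)..x, k y * f y| ≤ ∫ y in (0 : ℝ)..x, C * |f y| := by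
          rw [← Real.norm_eq_abs]
          refine intervalIntegral.norm_integral_le_of_norm_le hx.1
            (Filter.Eventually.of_forall fun y hy => ?_) h_int_x
          rw [Real.norm_eq_abs, abs_mul]
          exact mul_le_mul_of_nonneg_right (hk y hy.1.le hy.2) (abs_nonneg _)
      _ ≤ ∫ y in (0 : ℝ)..1, C * |f y| :=
          intervalIntegral.integral_mono_interval le_rfl hx.1 hx.2
            (Filter.Eventually.of_forall fun y => mul_nonneg hC (abs_nonneg _)) h_int
      _ = C * ∫ y in (0 : ℝ)..1, |f y| := intervalIntegral.integral_const_mul _ _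
  calc (∫ y in (0 : ℝ)..x, k y * f y) ^ 2 = |∫ y in (0 : ℝ)..x, k y * f y| ^ 2 := (sq_abs _).symm
    _ ≤ (C * ∫ y in (0 : ℝ)..1, |f y|) ^ 2 := pow_le_pow_left₀ (abs_nonneg _) h_le 2
    _ = C ^ 2 * (∫ y in (0 : ℝ)..1, |f y|) ^ 2 := mul_pow _ _ _
    _ ≤ C ^ 2 * ∫ y in (0 : ℝ)..1, (f y) ^ 2 :=
        mul_le_mul_of_nonneg_left (sq_integral_abs_le_integral_sq hf) (sq_nonneg C)

theorem integral_sq_le_of_sq_le {f g : ℝ → ℝ} {a b : ℝ}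
    (hf : ContinuousOn f (Set.Icc (0 : ℝ) 1))
    (h : ∀ x ∈ Set.Icc (0 : ℝ) 1, (g x) ^ 2 ≤ a * (f x) ^ 2 + b) :
    ∫ x in (0 : ℝ)..1, (g x) ^ 2 ≤ a * (∫ x in (0 : ℝ)..1, (f x) ^ 2) + b := by
  have hf' : ContinuousOn f (Set.uIcc (0 : ℝ) 1) := by rwa [Set.uIcc_of_le zero_le_one]
  have h_sq : IntervalIntegrable (fun x => a * (f x) ^ 2) MeasureTheory.volume 0 1 :=
    (hf'.pow 2).intervalIntegrable.const_mul a
  have h_int : IntervalIntegrable (fun x => a * (f x) ^ 2 + b) MeasureTheory.volume 0 1 :=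
    h_sq.add intervalIntegrable_const
  calc ∫ x in (0 : ℝ)..1, (g x) ^ 2 ≤ ∫ x in (0 : ℝ)..1, (a * (f x) ^ 2 + b) := by
        rw [intervalIntegral.integral_of_le zero_le_one,
          intervalIntegral.integral_of_le zero_le_one]
        refine MeasureTheory.integral_mono_of_nonneg
          (Filter.Eventually.of_forall fun x => sq_nonneg _) h_int.1 ?_
        filter_upwards [MeasureTheory.ae_restrict_mem measurableSet_Ioc] with x hx
        exact h x ⟨hx.1.le, hx.2⟩
    _ = a * (∫ x in (0 : ℝ)..1, (f x) ^ 2) + b := by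
        rw [intervalIntegral.integral_add h_sq intervalIntegrable_const,
          intervalIntegral.integral_const_mul, intervalIntegral.integral_const]
        simp

/-- Norm bound for the inverse backstepping transformation:
`u(x) = w(x) + ∫₀ˣ l(x,y)w(y)dy`,
`v(x) = z(x) + ∫₀¹ η(x,y)w(y)dy + D̂·∫₀ˣ p(x−y)z(y)dy`,
then `‖u‖² + ‖v‖² ≤ (2 + 2l̄² + 3η̄²)‖w‖² + (3 + 3D̄²p̄²)‖z‖²`. -/
theorem inverse_transformation_norm_bound
    (w z : ℝ → ℝ)
    (hw : ContinuousOn w (Set.Icc (0 : ℝ) 1))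
    (hz : ContinuousOn z (Set.Icc (0 : ℝ) 1))
    (lbar etabar pbar Dbar Dhat : ℝ)
    (hlbar : 0 ≤ lbar) (hetabar : 0 ≤ etabar) (hpbar : 0 ≤ pbar) (hDbar : 0 ≤ Dbar)
    (l eta : ℝ → ℝ → ℝ) (p : ℝ → ℝ)
    (hl : ∀ x y : ℝ, 0 ≤ y → y ≤ x → x ≤ 1 → |l x y| ≤ lbar)
    (heta : ∀ x ∈ Set.Icc (0 : ℝ) 1, ∀ y ∈ Set.Icc (0 : ℝ) 1, |eta x y| ≤ etabar)
    (hp : ∀ s ∈ Set.Icc (0 : ℝ) 1, |p s| ≤ pbar)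
    (hDhat0 : 0 ≤ Dhat) (hDhat1 : Dhat ≤ Dbar)
    (u v : ℝ → ℝ)
    (hu : ∀ x ∈ Set.Icc (0 : ℝ) 1, u x = w x + ∫ y in (0 : ℝ)..x, l x y * w y)
    (hv : ∀ x ∈ Set.Icc (0 : ℝ) 1,
      v x = z x + (∫ y in (0 : ℝ)..1, eta x y * w y)
        + Dhat * ∫ y in (0 : ℝ)..x, p (x - y) * z y) :
    (∫ x in (0 : ℝ)..1, (u x) ^ 2) + (∫ x in (0 : ℝ)..1, (v x) ^ 2)
      ≤ (2 + 2 * lbar ^ 2 + 3 * etabar ^ 2) * (∫ x in (0 : ℝ)..1, (w x) ^ 2)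
        + (3 + 3 * Dbar ^ 2 * pbar ^ 2) * (∫ x in (0 : ℝ)..1, (z x) ^ 2) := by
  have h_u := integral_sq_le_of_sq_le (g := u) (a := 2)
    (b := 2 * (lbar ^ 2 * ∫ x in (0 : ℝ)..1, (w x) ^ 2)) hw fun x hx => by
      have h_l := sq_integral_kernel_mul_le (k := l x) hw hx hlbar
        fun y hy hyx => hl x y hy hyx hx.2
      rw [hu x hx]
      nlinarith [sq_nonneg (w x - ∫ y in (0 : ℝ)..x, l x y * w y)]
  have h_v := integral_sq_le_of_sq_le (g := v) (a := 3)
    (b := 3 * (etabar ^ 2 * ∫ x in (0 : ℝ)..1, (w x) ^ 2)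
      + 3 * (Dbar ^ 2 * (pbar ^ 2 * ∫ x in (0 : ℝ)..1, (z x) ^ 2))) hz fun x hx => by
      have h_eta := sq_integral_kernel_mul_le (k := eta x) hw
        (Set.right_mem_Icc.mpr zero_le_one) hetabar fun y hy hy1 => heta x hx y ⟨hy, hy1⟩
      have h_p := sq_integral_kernel_mul_le (k := fun y => p (x - y)) hz hx hpbar
        fun y hy hyx => hp (x - y) ⟨sub_nonneg.mpr hyx, by linarith [hx.2]⟩
      have h_D := mul_le_mul (pow_le_pow_left₀ hDhat0 hDhat1 2) h_p (sq_nonneg _)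
        (sq_nonneg Dbar)
      rw [← mul_pow] at h_D
      rw [hv x hx]
      set A := ∫ y in (0 : ℝ)..1, eta x y * w y
      set B := Dhat * ∫ y in (0 : ℝ)..x, p (x - y) * z y
      nlinarith [sq_nonneg (z x - A), sq_nonneg (z x - B), sq_nonneg (A - B)]
  linarith
end

section
/- Let w, z : [0,1] → ℝ be continuous. Let M̄₁, M̄₂ ≥ 0 and suppose M₁ : [0,1] → ℝ satisfies |M₁(x)| ≤ M̄₁ and M₂ : [0,1]² → ℝ satisfies |M₂(x,y)| ≤ M̄₂. Define P₁(x) = z(0)·M₁(x) + ∫₀¹ w(y)·M₂(x,y) dy. Then |∫₀¹ (1+x)·z(x)·P₁(x) dx| ≤ (M̄₁ + M̄₂)·(‖w‖² + ‖z‖² + z(0)²). -/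
/-- On the unit interval, the squared integral is at most the integral of the square. -/
theorem sq_intervalIntegral_le_intervalIntegral_sq {f : ℝ → ℝ}
    (hf : IntervalIntegrable f MeasureTheory.volume 0 1)
    (hf2 : IntervalIntegrable (fun x => f x ^ 2) MeasureTheory.volume 0 1) :
    (∫ x in (0 : ℝ)..1, f x) ^ 2 ≤ ∫ x in (0 : ℝ)..1, f x ^ 2 := by
  set W := ∫ x in (0 : ℝ)..1, f x with hW
  have hnonneg : 0 ≤ ∫ x in (0 : ℝ)..1, (f x - W) ^ 2 :=
    intervalIntegral.integral_nonneg zero_le_one fun x _ => sq_nonneg _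
  have hexpand : ∫ x in (0 : ℝ)..1, (f x - W) ^ 2 = (∫ x in (0 : ℝ)..1, f x ^ 2) - W ^ 2 := by
    have hfun : (fun x => (f x - W) ^ 2) = fun x => f x ^ 2 - (2 * W) * f x + W ^ 2 := by
      ext x; ring
    rw [hfun, intervalIntegral.integral_add (hf2.sub (hf.const_mul _)) intervalIntegrable_const,
      intervalIntegral.integral_sub hf2 (hf.const_mul _), intervalIntegral.integral_const_mul,
      intervalIntegral.integral_const, ← hW]
    simp only [sub_zero, one_smul]
    ring
  linarith

/-- Bound on the cross term involving the perturbation `P₁(x) = z(0)M₁(x) + ∫₀¹ w(y)M₂(x,y)dy`: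
`|∫₀¹ (1+x)z(x)P₁(x)dx| ≤ (M̄₁ + M̄₂)(‖w‖² + ‖z‖² + z(0)²)`. -/
theorem P1_cross_term_bound
    (w z : ℝ → ℝ)
    (hw : ContinuousOn w (Set.Icc (0 : ℝ) 1))
    (hz : ContinuousOn z (Set.Icc (0 : ℝ) 1))
    (M1bar M2bar : ℝ) (hM1bar : 0 ≤ M1bar) (hM2bar : 0 ≤ M2bar)
    (M1 : ℝ → ℝ) (M2 : ℝ → ℝ → ℝ)
    (hM1 : ∀ x ∈ Set.Icc (0 : ℝ) 1, |M1 x| ≤ M1bar)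
    (hM2 : ∀ x ∈ Set.Icc (0 : ℝ) 1, ∀ y ∈ Set.Icc (0 : ℝ) 1, |M2 x y| ≤ M2bar)
    (P1 : ℝ → ℝ)
    (hP1 : ∀ x ∈ Set.Icc (0 : ℝ) 1,
      P1 x = z 0 * M1 x + ∫ y in (0 : ℝ)..1, w y * M2 x y) :
    |∫ x in (0 : ℝ)..1, (1 + x) * z x * P1 x|
      ≤ (M1bar + M2bar) *
        ((∫ x in (0 : ℝ)..1, (w x) ^ 2) + (∫ x in (0 : ℝ)..1, (z x) ^ 2) + (z 0) ^ 2) := by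
  have hab : (0 : ℝ) ≤ 1 := zero_le_one
  have hiw : IntervalIntegrable (fun y => |w y|) MeasureTheory.volume 0 1 :=
    hw.abs.intervalIntegrable_of_Icc hab
  have hiw2 : IntervalIntegrable (fun y => |w y| ^ 2) MeasureTheory.volume 0 1 :=
    (hw.abs.pow 2).intervalIntegrable_of_Icc hab
  have hiz2 : IntervalIntegrable (fun x => z x ^ 2) MeasureTheory.volume 0 1 :=
    (hz.pow 2).intervalIntegrable_of_Icc hab
  have hW := sq_intervalIntegral_le_intervalIntegral_sq hiw hiw2
  simp only [sq_abs] at hW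
  have hW0 : 0 ≤ ∫ y in (0 : ℝ)..1, |w y| :=
    intervalIntegral.integral_nonneg hab fun y _ => abs_nonneg _
  have hinner : ∀ x ∈ Set.Icc (0 : ℝ) 1,
      |∫ y in (0 : ℝ)..1, w y * M2 x y| ≤ M2bar * ∫ y in (0 : ℝ)..1, |w y| := by
    intro x hx
    rw [← intervalIntegral.integral_const_mul, ← Real.norm_eq_abs]
    refine intervalIntegral.norm_integral_le_of_norm_le hab
      (Filter.Eventually.of_forall fun y hy => ?_) (hiw.const_mul _)
    rw [Real.norm_eq_abs, abs_mul, mul_comm]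
    exact mul_le_mul_of_nonneg_right (hM2 x hx y (Set.Ioc_subset_Icc_self hy)) (abs_nonneg _)
  set W := ∫ y in (0 : ℝ)..1, |w y|
  have hz2 : 0 ≤ ∫ x in (0 : ℝ)..1, z x ^ 2 :=
    intervalIntegral.integral_nonneg hab fun x _ => sq_nonneg _
  have hw2 : 0 ≤ ∫ x in (0 : ℝ)..1, w x ^ 2 :=
    intervalIntegral.integral_nonneg hab fun x _ => sq_nonneg _
  have hpoint : ∀ x ∈ Set.Icc (0 : ℝ) 1, |(1 + x) * z x * P1 x| ≤
      (M1bar + M2bar) * z x ^ 2 + (M1bar * z 0 ^ 2 + M2bar * W ^ 2) := by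
    intro x hx
    have hP : |P1 x| ≤ M1bar * |z 0| + M2bar * W := by
      rw [hP1 x hx]
      refine (abs_add_le _ _).trans (add_le_add ?_ (hinner x hx))
      rw [abs_mul, mul_comm]
      exact mul_le_mul_of_nonneg_right (hM1 x hx) (abs_nonneg _)
    have hx2 : |1 + x| ≤ 2 := by
      rw [abs_le]; constructor <;> linarith [hx.1, hx.2]
    calc |(1 + x) * z x * P1 x| = |1 + x| * |z x| * |P1 x| := by rw [abs_mul, abs_mul]
      _ ≤ 2 * |z x| * (M1bar * |z 0| + M2bar * W) := by gcongr
      _ ≤ (M1bar + M2bar) * z x ^ 2 + (M1bar * z 0 ^ 2 + M2bar * W ^ 2) := by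
        rw [← sq_abs (z x), ← sq_abs (z 0)]
        nlinarith [mul_nonneg hM1bar (sq_nonneg (|z x| - |z 0|)),
          mul_nonneg hM2bar (sq_nonneg (|z x| - W))]
  have hmain : |∫ x in (0 : ℝ)..1, (1 + x) * z x * P1 x| ≤
      ∫ x in (0 : ℝ)..1, ((M1bar + M2bar) * z x ^ 2 + (M1bar * z 0 ^ 2 + M2bar * W ^ 2)) := by
    rw [← Real.norm_eq_abs]
    exact intervalIntegral.norm_integral_le_of_norm_le hab
      (Filter.Eventually.of_forall fun x hx => hpoint x (Set.Ioc_subset_Icc_self hx))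
      ((hiz2.const_mul _).add intervalIntegrable_const)
  rw [intervalIntegral.integral_add (hiz2.const_mul _) intervalIntegrable_const,
    intervalIntegral.integral_const_mul, intervalIntegral.integral_const, sub_zero,
    one_smul] at hmain
  nlinarith [mul_le_mul_of_nonneg_left hW hM2bar, mul_nonneg hM1bar hw2,
    mul_nonneg hM2bar (sq_nonneg (z 0))]
end
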